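/- arXiv:0810.5362 — 3 statements merged into one kernel-verified Lean document; each statement's English description precedes it below -/
import Mathlib

section
/- For every n ≥ 5, the GCM graph of affine type D̃ on n nodes—nodes 1 and 2 each joined to node 3, a path 3, 4, …, n−2, and nodes n−1 and n each joined to node n−2, with every amplitude equal to −1—is not admissible: there is no nonzero dominant position on it from which some game sequence converges. -/
/-- Firing node `i` transforms the position `lam` by `lam j ↦ lam j - M i j * lam i`. -/
def fire (M : ℕ → ℕ → ℤ) (lam : ℕ → ℝ) (i : ℕ) : ℕ → ℝ :=
  fun j => lam j - (M i j : ℝ) * lam i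

/-- The position obtained from `lam` by firing the nodes of a list in order. -/
def fireList (M : ℕ → ℕ → ℤ) : (ℕ → ℝ) → List ℕ → (ℕ → ℝ)
  | lam, [] => lam
  | lam, i :: s => fireList M (fire M lam i) s

/-- A list of node firings is legal from `lam` (on the graph with node set `{1,…,n}`)
if each fired node is a node of the graph carrying a positive number at the time of firing. -/
def LegalSeq (n : ℕ) (M : ℕ → ℕ → ℤ) : (ℕ → ℝ) → List ℕ → Prop
  | _, [] => True
  | lam, i :: s => 1 ≤ i ∧ i ≤ n ∧ 0 < lam i ∧ LegalSeq n M (fire M lam i) s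

/-- A convergent game sequence from `lam` on the graph with node set `{1,…,n}`:
a legal firing sequence after which no node has a positive number. -/
def ConvSeq (n : ℕ) (M : ℕ → ℕ → ℤ) (lam : ℕ → ℝ) (s : List ℕ) : Prop :=
  LegalSeq n M lam s ∧ ∀ i, 1 ≤ i → i ≤ n → fireList M lam s i ≤ 0

/-- The sequence of positions along an infinite firing sequence `f`. -/
def posSeq (M : ℕ → ℕ → ℤ) (lam : ℕ → ℝ) (f : ℕ → ℕ) : ℕ → (ℕ → ℝ)
  | 0 => lam
  | k + 1 => fire M (posSeq M lam f k) (f k)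

/-- A divergent game sequence from `lam` on the graph with node set `{1,…,n}`:
an infinite sequence of legal firings of nodes of the graph. -/
def DivergentSeq (n : ℕ) (M : ℕ → ℕ → ℤ) (lam : ℕ → ℝ) (f : ℕ → ℕ) : Prop :=
  ∀ k, 1 ≤ f k ∧ f k ≤ n ∧ 0 < posSeq M lam f k (f k)

/-- A GCM graph with node set `{1,…,n}` is admissible if there is a nonzero dominant
position from which some game sequence converges. -/
def Admissible (n : ℕ) (M : ℕ → ℕ → ℤ) : Prop :=
  ∃ lam : ℕ → ℝ, (∀ i, 1 ≤ i → i ≤ n → 0 ≤ lam i) ∧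
    (∃ i, 1 ≤ i ∧ i ≤ n ∧ lam i ≠ 0) ∧ ∃ s : List ℕ, ConvSeq n M lam s

/-- The GCM graph of affine type `D̃` on `n` nodes (`n ≥ 5`): edges `{1,3}`, `{2,3}`,
`{i,i+1}` for `3 ≤ i ≤ n-3`, `{n-2,n-1}` and `{n-2,n}`, all amplitudes `-1`. -/
def MDtilde (n : ℕ) : ℕ → ℕ → ℤ := fun i j =>
  if i = j then 2
  else if (min i j, max i j) = (1, 3) ∨ (min i j, max i j) = (2, 3) ∨
          (3 ≤ min i j ∧ min i j ≤ n - 3 ∧ max i j = min i j + 1) ∨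
          (min i j, max i j) = (n - 2, n - 1) ∨ (min i j, max i j) = (n - 2, n) then -1
  else 0

/-- The coefficients of the null root of affine type `D̃`: `1` at the four end nodes and `2`
at the inner nodes. -/
def nullMark (n : ℕ) (j : ℕ) : ℤ := if j ≤ 2 ∨ n ≤ j + 1 then 1 else 2

lemma nullMark_pos (n j : ℕ) : 0 < nullMark n j := by
  unfold nullMark
  split_ifs <;> norm_num

lemma MDtilde_mul_nullMark_sum (n : ℕ) (hn : 5 ≤ n) (i : ℕ) (h1 : 1 ≤ i) (h2 : i ≤ n) :
    ∑ j ∈ Finset.Icc 1 n, MDtilde n i j * nullMark n j = 0 := by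
  have reduce (f : ℕ → ℤ) (hf : ∀ j ∈ Finset.Icc 1 n, MDtilde n i j * nullMark n j = f j)
      (h : ∑ j ∈ Finset.Icc 1 n, f j = 0) :
      ∑ j ∈ Finset.Icc 1 n, MDtilde n i j * nullMark n j = 0 :=
    (Finset.sum_congr rfl hf).trans h
  have ind (a : ℕ) (c : ℤ) (ha : 1 ≤ a) (han : a ≤ n) :
      ∑ j ∈ Finset.Icc 1 n, (if j = a then c else 0) = c := by
    rw [Finset.sum_ite_eq', if_pos (Finset.mem_Icc.2 ⟨ha, han⟩)]
  have leaf (b : ℕ) (hb : 1 ≤ b) (hbn : b ≤ n)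
      (hf : ∀ j ∈ Finset.Icc 1 n, MDtilde n i j * nullMark n j =
        (if j = i then 2 else 0) + (if j = b then -2 else 0)) :
      ∑ j ∈ Finset.Icc 1 n, MDtilde n i j * nullMark n j = 0 := by
    refine reduce _ hf ?_
    rw [Finset.sum_add_distrib, ind i _ h1 h2, ind b _ hb hbn]
    norm_num
  have fork (a b c : ℕ) (ha : 1 ≤ a) (han : a ≤ n) (hb : 1 ≤ b) (hbn : b ≤ n)
      (hc : 1 ≤ c) (hcn : c ≤ n)
      (hf : ∀ j ∈ Finset.Icc 1 n, MDtilde n i j * nullMark n j =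
        (if j = i then 4 else 0) + (if j = a then -1 else 0) + (if j = b then -1 else 0)
          + (if j = c then -2 else 0)) :
      ∑ j ∈ Finset.Icc 1 n, MDtilde n i j * nullMark n j = 0 := by
    refine reduce _ hf ?_
    rw [Finset.sum_add_distrib, Finset.sum_add_distrib, Finset.sum_add_distrib, ind i _ h1 h2,
      ind a _ ha han, ind b _ hb hbn, ind c _ hc hcn]
    norm_num
  have cases_i : i ≤ 2 ∨ n ≤ i + 1 ∨ (i = 3 ∧ n = 5) ∨ (i = 3 ∧ 6 ≤ n) ∨ (i + 2 = n ∧ 6 ≤ n) ∨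
      (4 ≤ i ∧ i + 3 ≤ n) := by omega
  rcases cases_i with h | h | ⟨rfl, rfl⟩ | ⟨rfl, h⟩ | ⟨h, h'⟩ | ⟨h, h'⟩
  · refine leaf 3 (by omega) (by omega) fun j hj => ?_
    rw [Finset.mem_Icc] at hj
    simp only [MDtilde, nullMark, Prod.mk.injEq]
    split_ifs <;> omega
  · refine leaf (n - 2) (by omega) (by omega) fun j hj => ?_
    rw [Finset.mem_Icc] at hj
    simp only [MDtilde, nullMark, Prod.mk.injEq]
    split_ifs <;> omega
  · decide
  · refine fork 1 2 4 (by omega) (by omega) (by omega) (by omega) (by omega) (by omega)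
      fun j hj => ?_
    rw [Finset.mem_Icc] at hj
    simp only [MDtilde, nullMark, Prod.mk.injEq]
    split_ifs <;> omega
  · refine fork (n - 1) n (n - 3) (by omega) (by omega) (by omega) (by omega) (by omega)
      (by omega) fun j hj => ?_
    rw [Finset.mem_Icc] at hj
    simp only [MDtilde, nullMark, Prod.mk.injEq]
    split_ifs <;> omega
  · refine reduce (fun j => (if j = i then 4 else 0) + (if j = i - 1 then -2 else 0)
      + (if j = i + 1 then -2 else 0)) (fun j hj => ?_) ?_
    · rw [Finset.mem_Icc] at hj
      simp only [MDtilde, nullMark, Prod.mk.injEq]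
      split_ifs <;> omega
    · rw [Finset.sum_add_distrib, Finset.sum_add_distrib, ind i _ h1 h2,
        ind (i - 1) _ (by omega) (by omega), ind (i + 1) _ (by omega) (by omega)]
      norm_num

/-- A weight in the right kernel of the matrix pairs equally with a position before and after
a legal firing sequence. -/
lemma sum_mul_fireList {n : ℕ} {M : ℕ → ℕ → ℤ} {d : ℕ → ℤ}
    (hd : ∀ i, 1 ≤ i → i ≤ n → ∑ j ∈ Finset.Icc 1 n, M i j * d j = 0)
    (s : List ℕ) (lam : ℕ → ℝ) (hs : LegalSeq n M lam s) :
    ∑ j ∈ Finset.Icc 1 n, (d j : ℝ) * fireList M lam s j =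
      ∑ j ∈ Finset.Icc 1 n, (d j : ℝ) * lam j := by
  induction s generalizing lam with
  | nil => rfl
  | cons i s ih =>
    obtain ⟨h1, h2, -, hs⟩ := hs
    have key : ∑ j ∈ Finset.Icc 1 n, (M i j : ℝ) * d j = 0 := by exact_mod_cast hd i h1 h2
    calc ∑ j ∈ Finset.Icc 1 n, (d j : ℝ) * fireList M lam (i :: s) j
        = ∑ j ∈ Finset.Icc 1 n, (d j : ℝ) * fire M lam i j := ih _ hs
      _ = ∑ j ∈ Finset.Icc 1 n, ((d j : ℝ) * lam j - (M i j : ℝ) * d j * lam i) :=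
          Finset.sum_congr rfl fun j _ => by simp only [fire]; ring
      _ = ∑ j ∈ Finset.Icc 1 n, (d j : ℝ) * lam j := by
          rw [Finset.sum_sub_distrib, ← Finset.sum_mul, key, zero_mul, sub_zero]

/-- For every `n ≥ 5`, the affine type `D̃` GCM graph on `n` nodes is not admissible. -/
theorem Dtilde_not_admissible (n : ℕ) (hn : 5 ≤ n) : ¬ Admissible n (MDtilde n) := by
  rintro ⟨lam, hdom, ⟨i, hi1, hin, hi⟩, s, hs, hfin⟩
  have hpos (j : ℕ) : (0 : ℝ) < nullMark n j := by exact_mod_cast nullMark_pos n j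
  have hinv := sum_mul_fireList (MDtilde_mul_nullMark_sum n hn) s lam hs
  have hstart : 0 < ∑ j ∈ Finset.Icc 1 n, (nullMark n j : ℝ) * lam j := by
    refine Finset.sum_pos' (fun j hj => ?_) ⟨i, Finset.mem_Icc.2 ⟨hi1, hin⟩, ?_⟩
    · obtain ⟨hj1, hjn⟩ := Finset.mem_Icc.1 hj
      exact mul_nonneg (hpos j).le (hdom j hj1 hjn)
    · exact mul_pos (hpos i) (lt_of_le_of_ne (hdom i hi1 hin) hi.symm)
  have hend : ∑ j ∈ Finset.Icc 1 n, (nullMark n j : ℝ) * fireList (MDtilde n) lam s j ≤ 0 := by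
    refine Finset.sum_nonpos fun j hj => ?_
    obtain ⟨hj1, hjn⟩ := Finset.mem_Icc.1 hj
    exact mul_nonpos_of_nonneg_of_nonpos (hpos j).le (hfin j hj1 hjn)
  linarith
end

section
/- The GCM graph of affine type Ẽ_6—seven nodes 1,…,7 with edges {1,4}, {4,5}, {5,6}, {6,7}, {3,5}, {2,3}, every amplitude equal to −1—is not admissible: there is no nonzero dominant position on it from which some game sequence converges. -/
/-- The GCM graph of affine type `Ẽ₆` on nodes `{1,…,7}`: edges `{1,4}`, `{4,5}`,
`{5,6}`, `{6,7}`, `{3,5}` and `{2,3}`, all amplitudes `-1`. -/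
def ME6tilde : ℕ → ℕ → ℤ := fun i j =>
  if i = j then 2
  else if (min i j, max i j) = (1, 4) ∨ (min i j, max i j) = (4, 5) ∨
          (min i j, max i j) = (5, 6) ∨ (min i j, max i j) = (6, 7) ∨
          (min i j, max i j) = (3, 5) ∨ (min i j, max i j) = (2, 3) then -1
  else 0

/-- The pairing of a position with the null root `(1, 1, 2, 2, 3, 2, 1)` of `Ẽ₆`. -/
def nullRootPairing (lam : ℕ → ℝ) : ℝ :=
  lam 1 + lam 2 + 2 * lam 3 + 2 * lam 4 + 3 * lam 5 + 2 * lam 6 + lam 7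

theorem nullRootPairing_fire (lam : ℕ → ℝ) {i : ℕ} (h₁ : 1 ≤ i) (h₇ : i ≤ 7) :
    nullRootPairing (fire ME6tilde lam i) = nullRootPairing lam := by
  interval_cases i <;> norm_num [nullRootPairing, fire, ME6tilde] <;> ring

theorem nullRootPairing_fireList (s : List ℕ) (lam : ℕ → ℝ) (h : LegalSeq 7 ME6tilde lam s) :
    nullRootPairing (fireList ME6tilde lam s) = nullRootPairing lam := by
  induction s generalizing lam with
  | nil => rfl
  | cons i s ih =>
    obtain ⟨h₁, h₇, -, hs⟩ := h
    exact (ih _ hs).trans (nullRootPairing_fire lam h₁ h₇)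

theorem nullRootPairing_nonpos {lam : ℕ → ℝ} (h : ∀ i, 1 ≤ i → i ≤ 7 → lam i ≤ 0) :
    nullRootPairing lam ≤ 0 := by
  unfold nullRootPairing
  linarith [h 1 (by simp) (by simp), h 2 (by simp) (by simp), h 3 (by simp) (by simp),
    h 4 (by simp) (by simp), h 5 (by simp) (by simp), h 6 (by simp) (by simp),
    h 7 (by simp) (by simp)]

theorem nullRootPairing_pos {lam : ℕ → ℝ} (h : ∀ i, 1 ≤ i → i ≤ 7 → 0 ≤ lam i)
    {i : ℕ} (h₁ : 1 ≤ i) (h₇ : i ≤ 7) (hi : lam i ≠ 0) : 0 < nullRootPairing lam := by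
  have hpos : 0 < lam i := (h i h₁ h₇).lt_of_ne' hi
  unfold nullRootPairing
  interval_cases i <;>
    linarith [h 1 (by simp) (by simp), h 2 (by simp) (by simp), h 3 (by simp) (by simp),
      h 4 (by simp) (by simp), h 5 (by simp) (by simp), h 6 (by simp) (by simp),
      h 7 (by simp) (by simp)]

/-- The affine type `Ẽ₆` GCM graph is not admissible. -/
theorem E6tilde_not_admissible : ¬ Admissible 7 ME6tilde := by
  rintro ⟨lam, hdom, ⟨i, h₁, h₇, hi⟩, s, hs, hend⟩
  have hpos := nullRootPairing_pos hdom h₁ h₇ hi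
  rw [← nullRootPairing_fireList s lam hs] at hpos
  exact hpos.not_ge (nullRootPairing_nonpos hend)
end

section
/- Let p_1, q_1, p_2, q_2 be positive integers. The three-node cycle GCM graph with node set {1,2,3} and M_{12} = −q_1, M_{21} = −p_1, M_{13} = −q_2, M_{31} = −p_2, M_{23} = M_{32} = −1 is not admissible: there is no nonzero dominant position on it from which some game sequence converges. -/
/-- The three-node cycle GCM graph with `M 1 2 = -q₁`, `M 2 1 = -p₁`, `M 1 3 = -q₂`,
`M 3 1 = -p₂` and `M 2 3 = M 3 2 = -1`. -/
def Mtriangle (p1 q1 p2 q2 : ℤ) : ℕ → ℕ → ℤ := fun i j =>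
  if i = j then 2
  else if (i, j) = (1, 2) then -q1
  else if (i, j) = (2, 1) then -p1
  else if (i, j) = (1, 3) then -q2
  else if (i, j) = (3, 1) then -p2
  else if (i, j) = (2, 3) ∨ (i, j) = (3, 2) then -1
  else 0

/-- If every row sum of `M` is nonpositive, then legal firing never decreases the sum of the
numbers on the nodes. -/
theorem sum_le_sum_fireList {n : ℕ} {M : ℕ → ℕ → ℤ}
    (hM : ∀ i, 1 ≤ i → i ≤ n → ∑ j ∈ Finset.Icc 1 n, M i j ≤ 0) (s : List ℕ) (lam : ℕ → ℝ)
    (hs : LegalSeq n M lam s) :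
    ∑ j ∈ Finset.Icc 1 n, lam j ≤ ∑ j ∈ Finset.Icc 1 n, fireList M lam s j := by
  induction s generalizing lam with
  | nil => exact le_rfl
  | cons i s ih =>
    obtain ⟨h1, hn, hpos, hs⟩ := hs
    refine le_trans ?_ (ih _ hs)
    have hrow : (∑ j ∈ Finset.Icc 1 n, (M i j : ℝ)) ≤ 0 := by exact_mod_cast hM i h1 hn
    simp only [fire, Finset.sum_sub_distrib, ← Finset.sum_mul]
    linarith [mul_nonpos_of_nonpos_of_nonneg hrow hpos.le]

/-- A GCM graph all of whose row sums are nonpositive is not admissible. -/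
theorem not_admissible_of_row_sum_nonpos {n : ℕ} {M : ℕ → ℕ → ℤ}
    (hM : ∀ i, 1 ≤ i → i ≤ n → ∑ j ∈ Finset.Icc 1 n, M i j ≤ 0) : ¬ Admissible n M := by
  rintro ⟨lam, hdom, ⟨i, h1, hn, hi⟩, s, hs, hend⟩
  have hstart : 0 < ∑ j ∈ Finset.Icc 1 n, lam j :=
    Finset.sum_pos' (fun j hj => hdom j (Finset.mem_Icc.1 hj).1 (Finset.mem_Icc.1 hj).2)
      ⟨i, Finset.mem_Icc.2 ⟨h1, hn⟩, lt_of_le_of_ne (hdom i h1 hn) hi.symm⟩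
  have hfinal : ∑ j ∈ Finset.Icc 1 n, fireList M lam s j ≤ 0 :=
    Finset.sum_nonpos fun j hj => hend j (Finset.mem_Icc.1 hj).1 (Finset.mem_Icc.1 hj).2
  linarith [sum_le_sum_fireList hM s lam hs]

/-- For all positive integers `p₁, q₁, p₂, q₂`, the three-node cycle GCM graph with
amplitudes `-q₁, -p₁` and `-q₂, -p₂` on the edges at node `1` and amplitudes `-1, -1`
on the remaining edge is not admissible. -/
theorem triangle_not_admissible (p1 q1 p2 q2 : ℤ)
    (hp1 : 0 < p1) (hq1 : 0 < q1) (hp2 : 0 < p2) (hq2 : 0 < q2) :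
    ¬ Admissible 3 (Mtriangle p1 q1 p2 q2) := by
  refine not_admissible_of_row_sum_nonpos fun i h1 h3 => ?_
  have hIcc : Finset.Icc 1 3 = ({1, 2, 3} : Finset ℕ) := rfl
  interval_cases i <;> simp [hIcc, Mtriangle] <;> omega
end
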